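/- Let r be an odd prime, n = 2r, q = 2^a, and let V be the fully deleted permutation module for S_n over 𝔽_q (so p = 2 divides n and dim V = n − 2). Let g ∈ A_n be a product of two disjoint r-cycles. Then the characteristic polynomial of g on V equals ((X^r − 1)/(X − 1))², the fixed-point subspace of g on V is zero, and g is not an e-stingray element for any e. -/

import Mathlib

/-! The fully deleted permutation module `V = W/(W ∩ D)` for `Sₙ` over a finite field,
with the induced coordinate-permutation action, and stingray elements. -/

/-- The linear map `(x₁, …, xₙ) ↦ ∑ᵢ xᵢ` on `Fⁿ`. -/
noncomputable def sumCoords (F : Type*) [Field F] (n : ℕ) : (Fin n → F) →ₗ[F] F :=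
  ∑ i : Fin n, LinearMap.proj i

/-- `W = {x ∈ Fⁿ : ∑ᵢ xᵢ = 0}`. -/
noncomputable def Wsub (F : Type*) [Field F] (n : ℕ) : Submodule F (Fin n → F) :=
  LinearMap.ker (sumCoords F n)

/-- `D`, the span of the all-ones vector in `Fⁿ`. -/
noncomputable def Dsub (F : Type*) [Field F] (n : ℕ) : Submodule F (Fin n → F) :=
  Submodule.span F {fun _ => (1 : F)}

/-- `W ∩ D`, viewed as a submodule of `W`. -/
noncomputable def Nsub (F : Type*) [Field F] (n : ℕ) : Submodule F ↥(Wsub F n) :=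
  (Wsub F n ⊓ Dsub F n).comap (Wsub F n).subtype

/-- The fully deleted permutation module `V = W/(W ∩ D)` over `F`. -/
abbrev DelMod (F : Type*) [Field F] (n : ℕ) := ↥(Wsub F n) ⧸ Nsub F n

/-- The action of a permutation `σ` on `W` (permuting coordinates, `x ↦ x ∘ σ⁻¹`). -/
noncomputable def permW (F : Type*) [Field F] (n : ℕ) (σ : Equiv.Perm (Fin n)) :
    ↥(Wsub F n) →ₗ[F] ↥(Wsub F n) :=
  LinearMap.restrict (LinearMap.funLeft F F ⇑σ⁻¹)
    (p := Wsub F n) (q := Wsub F n) (by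
      intro x hx
      simp only [Wsub, LinearMap.mem_ker, sumCoords, LinearMap.sum_apply,
        LinearMap.proj_apply, LinearMap.funLeft_apply] at hx ⊢
      simpa using (Equiv.sum_comp σ⁻¹ x).trans hx)

/-- The induced action of a permutation `σ` on the fully deleted permutation module. -/
noncomputable def permDel (F : Type*) [Field F] (n : ℕ) (σ : Equiv.Perm (Fin n)) :
    Module.End F (DelMod F n) :=
  Submodule.mapQ (Nsub F n) (Nsub F n) (permW F n σ) (by
    intro x hx
    have hD : (x : Fin n → F) ∈ Dsub F n := hx.2
    refine Submodule.mem_comap.mpr (Submodule.mem_inf.mpr ⟨?_, ?_⟩)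
    · exact (permW F n σ x).2
    · rw [Submodule.subtype_apply]
      have hcoe : (permW F n σ x : Fin n → F)
          = LinearMap.funLeft F F ⇑σ⁻¹ (x : Fin n → F) :=
        LinearMap.restrict_coe_apply _ _ _
      rw [hcoe]
      rw [Dsub, Submodule.mem_span_singleton] at hD ⊢
      obtain ⟨c, hc⟩ := hD
      refine ⟨c, ?_⟩
      funext i
      simpa using congrFun hc (σ⁻¹ i))

/-- A linear endomorphism `g` of an `F`-vector space `M` is an `e`-stingray element if
`M = U ⊕ Fix(g)` where `Fix(g)` is the fixed-point subspace of `g` and `U` is a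
`g`-invariant subspace of dimension `e` on which `g` acts irreducibly. -/
def IsStingrayOn (F : Type*) [Field F] {M : Type*} [AddCommGroup M] [Module F M]
    (g : Module.End F M) (e : ℕ) : Prop :=
  ∃ U : Submodule F M,
    Module.finrank F ↥U = e ∧
    Submodule.map g U ≤ U ∧
    IsCompl U (LinearMap.ker (g - LinearMap.id)) ∧
    ∀ W : Submodule F M, W ≤ U → Submodule.map g W ≤ W → W = ⊥ ∨ W = U


section CyclicSubmodules

open Polynomial

variable {F V : Type*} [Field F] [AddCommGroup V] [Module F V]

/-- The linear map `F[X]/(P) → V`, `p ↦ p(f) v`; it is compatible with multiplication by the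
root as soon as `P(f) v = 0`. -/
noncomputable def AdjoinRoot.toCyclic {P : F[X]} (hP : P.Monic) (f : Module.End F V) (v : V) :
    AdjoinRoot P →ₗ[F] V :=
  LinearMap.applyₗ v ∘ₗ (aeval f).toLinearMap ∘ₗ AdjoinRoot.modByMonicHom hP

lemma AdjoinRoot.toCyclic_mk {P : F[X]} (hP : P.Monic) (f : Module.End F V) {v : V}
    (hv : aeval f P v = 0) (p : F[X]) :
    AdjoinRoot.toCyclic hP f v (AdjoinRoot.mk P p) = aeval f p v := by
  have h := congrArg (fun s => aeval f s v) (modByMonic_add_div p P)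
  simp only [map_add, mul_comm P, map_mul, LinearMap.add_apply, Module.End.mul_apply, hv,
    map_zero, add_zero] at h
  simpa [AdjoinRoot.toCyclic] using h

lemma AdjoinRoot.toCyclic_root_mul {P : F[X]} (hP : P.Monic) (f : Module.End F V) {v : V}
    (hv : aeval f P v = 0) (y : AdjoinRoot P) :
    AdjoinRoot.toCyclic hP f v (AdjoinRoot.root P * y) = f (AdjoinRoot.toCyclic hP f v y) := by
  obtain ⟨p, rfl⟩ := AdjoinRoot.mk_surjective y
  rw [← AdjoinRoot.mk_X, ← map_mul, toCyclic_mk hP f hv, toCyclic_mk hP f hv]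
  simp

lemma AdjoinRoot.map_range_toCyclic_le {P : F[X]} (hP : P.Monic) (f : Module.End F V) {v : V}
    (hv : aeval f P v = 0) :
    (LinearMap.range (AdjoinRoot.toCyclic hP f v)).map f ≤
      LinearMap.range (AdjoinRoot.toCyclic hP f v) := by
  rintro _ ⟨_, ⟨y, rfl⟩, rfl⟩
  exact ⟨_, toCyclic_root_mul hP f hv y⟩

lemma AdjoinRoot.mem_range_toCyclic {P : F[X]} (hP : P.Monic) (f : Module.End F V) {v : V}
    (hv : aeval f P v = 0) : v ∈ LinearMap.range (AdjoinRoot.toCyclic hP f v) :=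
  ⟨AdjoinRoot.mk P 1, by rw [toCyclic_mk hP f hv]; simp⟩

lemma AdjoinRoot.finrank_eq_natDegree {P : F[X]} (hP : P.Monic) :
    Module.finrank F (AdjoinRoot P) = P.natDegree := by
  rw [(AdjoinRoot.powerBasis' hP).finrank, AdjoinRoot.powerBasis'_dim]

lemma AdjoinRoot.charpoly_lmul_root {P : F[X]} [Module.Finite F (AdjoinRoot P)]
    (hP : P.Monic) :
    (Algebra.lmul F (AdjoinRoot P) (AdjoinRoot.root P)).charpoly = P := by
  have hgen : (AdjoinRoot.powerBasis hP.ne_zero).gen = AdjoinRoot.root P := rfl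
  rw [← LinearMap.charpoly_toMatrix _ (AdjoinRoot.powerBasis hP.ne_zero).basis,
    ← hgen, ← Algebra.leftMulMatrix_apply, charpoly_leftMulMatrix,
    AdjoinRoot.minpoly_powerBasis_gen_of_monic hP]

/-- If `V` has dimension `2 deg P` and is generated, as a module over `F[f]`, by two vectors
killed by `P(f)`, then `f` has characteristic polynomial `P ^ 2`. -/
lemma charpoly_eq_sq_of_generators [FiniteDimensional F V] {P : F[X]} (hP : P.Monic)
    (f : Module.End F V) {v w : V} (hv : aeval f P v = 0) (hw : aeval f P w = 0)
    (hdim : Module.finrank F V = 2 * P.natDegree)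
    (hgen : ∀ S : Submodule F V, S.map f ≤ S → v ∈ S → w ∈ S → S = ⊤) :
    f.charpoly = P ^ 2 := by
  have : Module.Finite F (AdjoinRoot P) := hP.finite_adjoinRoot
  have : Module.Free F (AdjoinRoot P) := hP.free_adjoinRoot
  let T : AdjoinRoot P × AdjoinRoot P →ₗ[F] V :=
    (AdjoinRoot.toCyclic hP f v).coprod (AdjoinRoot.toCyclic hP f w)
  let m := Algebra.lmul F (AdjoinRoot P) (AdjoinRoot.root P)
  have hsurj : LinearMap.range T = ⊤ := by
    simp only [T, LinearMap.range_coprod]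
    refine hgen _ ?_ (Submodule.mem_sup_left (AdjoinRoot.mem_range_toCyclic hP f hv))
      (Submodule.mem_sup_right (AdjoinRoot.mem_range_toCyclic hP f hw))
    rw [Submodule.map_sup]
    exact sup_le_sup (AdjoinRoot.map_range_toCyclic_le hP f hv)
      (AdjoinRoot.map_range_toCyclic_le hP f hw)
  have hfin : Module.finrank F (AdjoinRoot P × AdjoinRoot P) = Module.finrank F V := by
    rw [Module.finrank_prod, AdjoinRoot.finrank_eq_natDegree hP, hdim, two_mul]
  have hbij : Function.Bijective T :=
    ⟨(LinearMap.injective_iff_surjective_of_finrank_eq_finrank hfin).2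
      (LinearMap.range_eq_top.1 hsurj), LinearMap.range_eq_top.1 hsurj⟩
  let e := LinearEquiv.ofBijective T hbij
  have hconj : e.conj (m.prodMap m) = f := by
    ext x
    obtain ⟨⟨y, z⟩, rfl⟩ := e.surjective x
    rw [LinearEquiv.conj_apply_apply, LinearEquiv.symm_apply_apply]
    simp [e, T, m, AdjoinRoot.toCyclic_root_mul hP f hv, AdjoinRoot.toCyclic_root_mul hP f hw]
  rw [← hconj, LinearEquiv.charpoly_conj, LinearMap.charpoly_prodMap,
    AdjoinRoot.charpoly_lmul_root hP, sq]

/-- In the situation of `charpoly_eq_sq_of_generators`, the action of `f` is reducible. -/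
lemma exists_invariant_of_generators [FiniteDimensional F V] {P : F[X]} (hP : P.Monic)
    (hP0 : 0 < P.natDegree)
    (f : Module.End F V) {v w : V} (hv : aeval f P v = 0) (hw : aeval f P w = 0)
    (hdim : Module.finrank F V = 2 * P.natDegree)
    (hgen : ∀ S : Submodule F V, S.map f ≤ S → v ∈ S → w ∈ S → S = ⊤) :
    ∃ S : Submodule F V, S.map f ≤ S ∧ S ≠ ⊥ ∧ S ≠ ⊤ := by
  have : Module.Finite F (AdjoinRoot P) := hP.finite_adjoinRoot
  have hne : ∀ u : V, LinearMap.range (AdjoinRoot.toCyclic hP f u) ≠ ⊤ := by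
    intro u hu
    have h := LinearMap.finrank_range_le (AdjoinRoot.toCyclic hP f u)
    rw [hu, finrank_top, AdjoinRoot.finrank_eq_natDegree hP] at h
    omega
  refine ⟨_, AdjoinRoot.map_range_toCyclic_le hP f hv, fun h => hne w ?_, hne v⟩
  have hv0 : v = 0 := by
    have := AdjoinRoot.mem_range_toCyclic hP f hv
    rwa [h, Submodule.mem_bot] at this
  exact hgen _ (AdjoinRoot.map_range_toCyclic_le hP f hw) (hv0 ▸ Submodule.zero_mem _)
    (AdjoinRoot.mem_range_toCyclic hP f hw)

end CyclicSubmodules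

section DeletedPermutationModule

variable {F : Type*} [Field F] {n : ℕ}

lemma mem_Wsub {x : Fin n → F} : x ∈ Wsub F n ↔ ∑ i, x i = 0 := by
  simp [Wsub, sumCoords, LinearMap.sum_apply]

lemma single_sub_single_mem_Wsub (i j : Fin n) :
    (Pi.single i 1 - Pi.single j 1 : Fin n → F) ∈ Wsub F n := by
  simp [mem_Wsub]

/-- The class of `eᵢ - eⱼ` in the fully deleted permutation module. -/
noncomputable def delDiff (F : Type*) [Field F] {n : ℕ} (i j : Fin n) : DelMod F n :=
  (Nsub F n).mkQ ⟨Pi.single i 1 - Pi.single j 1, single_sub_single_mem_Wsub i j⟩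

lemma delDiff_self (i : Fin n) : delDiff F i i = 0 := by
  rw [delDiff, ← map_zero (Nsub F n).mkQ]
  congr 1
  ext1
  simp

lemma delDiff_add (i j k : Fin n) : delDiff F i j + delDiff F j k = delDiff F i k := by
  rw [delDiff, delDiff, delDiff, ← map_add]
  congr 1
  ext1
  simp

lemma permDel_delDiff (σ : Equiv.Perm (Fin n)) (i j : Fin n) :
    permDel F n σ (delDiff F i j) = delDiff F (σ i) (σ j) := by
  have hsingle : ∀ k : Fin n, LinearMap.funLeft F F ⇑σ⁻¹ (Pi.single k (1 : F)) =
      Pi.single (σ k) 1 := by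
    intro k
    ext l
    simp only [LinearMap.funLeft_apply, Pi.single_apply, Equiv.Perm.inv_eq_iff_eq]
  rw [permDel, delDiff, delDiff, Submodule.mkQ_apply, Submodule.mapQ_apply, Submodule.mkQ_apply]
  congr 1
  ext1
  rw [permW, LinearMap.coe_restrict_apply, map_sub, hsingle, hsingle]

lemma permDel_pow_delDiff (σ : Equiv.Perm (Fin n)) (k : ℕ) (i j : Fin n) :
    (permDel F n σ ^ k) (delDiff F i j) = delDiff F ((σ ^ k) i) ((σ ^ k) j) := by
  induction k with
  | zero => simp
  | succ k ih =>
    rw [pow_succ', Module.End.mul_apply, ih, permDel_delDiff, pow_succ', Equiv.Perm.mul_apply,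
      Equiv.Perm.mul_apply]

lemma sum_pow_permDel_delDiff (σ : Equiv.Perm (Fin n)) (i : Fin n) (m : ℕ) :
    ∑ k ∈ Finset.range m, (permDel F n σ ^ k) (delDiff F i (σ i)) =
      delDiff F i ((σ ^ m) i) := by
  induction m with
  | zero => simp [delDiff_self]
  | succ m ih =>
    rw [Finset.sum_range_succ, ih, permDel_pow_delDiff, delDiff_add, pow_succ,
      Equiv.Perm.mul_apply]

lemma aeval_permDel_delDiff {σ : Equiv.Perm (Fin n)} {r : ℕ} (hσ : σ ^ r = 1) (i : Fin n) :
    Polynomial.aeval (permDel F n σ) (∑ k ∈ Finset.range r, (Polynomial.X : Polynomial F) ^ k)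
      (delDiff F i (σ i)) = 0 := by
  simp only [map_sum, map_pow, Polynomial.aeval_X, LinearMap.sum_apply]
  rw [sum_pow_permDel_delDiff, hσ, Equiv.Perm.one_apply, delDiff_self]

lemma delDiff_pow_mem {σ : Equiv.Perm (Fin n)} {S : Submodule F (DelMod F n)}
    (hS : S.map (permDel F n σ) ≤ S) {i : Fin n} (hi : delDiff F i (σ i) ∈ S) (m : ℕ) :
    delDiff F i ((σ ^ m) i) ∈ S := by
  rw [← sum_pow_permDel_delDiff]
  refine Submodule.sum_mem _ fun k hk => ?_
  clear hk
  induction k with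
  | zero => simpa using hi
  | succ k ih =>
    rw [pow_succ', Module.End.mul_apply]
    exact hS (Submodule.mem_map_of_mem ih)

lemma finrank_Wsub_add_one (hn : 0 < n) : Module.finrank F (Wsub F n) + 1 = n := by
  have hsurj : LinearMap.range (sumCoords F n) = ⊤ := by
    refine LinearMap.range_eq_top.2 fun c => ⟨Pi.single ⟨0, hn⟩ c, ?_⟩
    simp [sumCoords, LinearMap.sum_apply]
  have h := (sumCoords F n).finrank_range_add_finrank_ker
  rw [hsurj, finrank_top, Module.finrank_self, Module.finrank_fin_fun] at h
  rw [Wsub]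
  omega

lemma finrank_DelMod (hn : 0 < n) (hchar : (n : F) = 0) :
    Module.finrank F (DelMod F n) = n - 2 := by
  have hDW : Dsub F n ≤ Wsub F n := by
    rw [Dsub, Submodule.span_singleton_le_iff_mem, mem_Wsub]
    simpa using hchar
  have hN : Module.finrank F (Nsub F n) = 1 := by
    have hne : (fun _ => 1 : Fin n → F) ≠ 0 := fun h => one_ne_zero (congrFun h ⟨0, hn⟩)
    rw [Nsub, inf_eq_right.2 hDW, (Submodule.comapSubtypeEquivOfLe hDW).finrank_eq, Dsub,
      finrank_span_singleton hne]
  have h : Module.finrank F (DelMod F n) + _ = _ := (Nsub F n).finrank_quotient_add_finrank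
  have hW := finrank_Wsub_add_one (F := F) hn
  omega

/-- A submodule of `V` containing all differences `eₐ - eᵢ` for `i ∈ A` and `e_b - eᵢ` for
`i ∉ A` is everything, if `A` and its complement have odd cardinality in characteristic two. -/
lemma eq_top_of_delDiff_mem [CharP F 2] {A : Finset (Fin n)} (hA : Odd A.card)
    (hAc : Odd (Aᶜ).card) {a b : Fin n} {S : Submodule F (DelMod F n)}
    (ha : ∀ i ∈ A, delDiff F a i ∈ S) (hb : ∀ i ∉ A, delDiff F b i ∈ S) : S = ⊤ := by
  set S' : Submodule F (Fin n → F) := (S.comap (Nsub F n).mkQ).map (Wsub F n).subtype with hS'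
  have hdiff : ∀ i j, delDiff F i j ∈ S → (Pi.single i 1 - Pi.single j 1 : Fin n → F) ∈ S' :=
    fun i j h => ⟨⟨_, single_sub_single_mem_Wsub i j⟩, h, rfl⟩
  let e : Fin n → Fin n → F := fun i => if i ∈ A then Pi.single a 1 else Pi.single b 1
  have he : ∀ i, e i - Pi.single i 1 ∈ S' := by
    intro i
    by_cases hi : i ∈ A
    · simpa [e, hi] using hdiff _ _ (ha i hi)
    · simpa [e, hi] using hdiff _ _ (hb i hi)
  have hsum : ∀ x : Fin n → F, ∑ i, x i • e i =
      (∑ i ∈ A, x i) • (Pi.single a 1 : Fin n → F) + (∑ i ∈ Aᶜ, x i) • Pi.single b 1 := by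
    intro x
    rw [← Finset.sum_add_sum_compl A, Finset.sum_smul, Finset.sum_smul]
    congr 1
    · exact Finset.sum_congr rfl fun i hi => by simp only [e, if_pos hi]
    · exact Finset.sum_congr rfl fun i hi => by simp only [e, if_neg (Finset.mem_compl.1 hi)]
  have hred : ∀ x : Fin n → F, ∑ i, x i • e i - x ∈ S' := by
    intro x
    have hx : ∑ i, x i • e i - x = ∑ i, x i • (e i - Pi.single i 1) := by
      simp only [smul_sub, Finset.sum_sub_distrib]
      congr 1
      ext j
      simp [Pi.single_apply]
    rw [hx]
    exact Submodule.sum_mem _ fun i _ => S'.smul_mem _ (he i)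
  have hcast : ∀ m : ℕ, Odd m → (m : F) = 1 := by
    rintro m ⟨k, rfl⟩
    simp [CharTwo.two_eq_zero]
  have hone : (fun _ => 1 : Fin n → F) ∈ S' := by
    have hW : (fun _ => 1 : Fin n → F) ∈ Wsub F n := by
      rw [mem_Wsub, ← Finset.sum_add_sum_compl A]
      simp [hcast _ hA, hcast _ hAc, CharTwo.add_self_eq_zero]
    refine ⟨⟨_, hW⟩, ?_, rfl⟩
    have hzero : (Nsub F n).mkQ ⟨_, hW⟩ = 0 := by
      rw [Submodule.mkQ_apply, Submodule.Quotient.mk_eq_zero]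
      exact ⟨hW, Submodule.mem_span_singleton_self _⟩
    change (Nsub F n).mkQ ⟨_, hW⟩ ∈ S
    rw [hzero]
    exact S.zero_mem
  have hab : (Pi.single a 1 + Pi.single b 1 : Fin n → F) ∈ S' := by
    have h := S'.add_mem (hred fun _ => 1) hone
    rw [sub_add_cancel, hsum] at h
    simpa [hcast _ hA, hcast _ hAc] using h
  rw [eq_top_iff]
  rintro y -
  obtain ⟨⟨x, hx⟩, rfl⟩ := (Nsub F n).mkQ_surjective y
  have hxS : x ∈ S' := by
    have hx0 := mem_Wsub.1 hx
    rw [← Finset.sum_add_sum_compl A, CharTwo.add_eq_zero] at hx0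
    have h := hred x
    rw [hsum, ← hx0, ← smul_add] at h
    simpa using S'.sub_mem (S'.smul_mem (∑ i ∈ A, x i) hab) h
  obtain ⟨z, hz, hzx⟩ := hxS
  have : z = ⟨x, hx⟩ := Subtype.ext hzx
  exact this ▸ hz

end DeletedPermutationModule

lemma not_isStingrayOn_of_invariant {F M : Type*} [Field F] [AddCommGroup M] [Module F M]
    {f : Module.End F M} (hfix : LinearMap.ker (f - LinearMap.id) = ⊥)
    {S : Submodule F M} (hS : S.map f ≤ S) (hbot : S ≠ ⊥) (htop : S ≠ ⊤) (e : ℕ) :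
    ¬ IsStingrayOn F f e := by
  rintro ⟨U, -, -, hcompl, hirr⟩
  rw [hfix] at hcompl
  have hU : U = ⊤ := by simpa using hcompl.sup_eq_top
  subst hU
  exact (hirr S le_top hS).elim hbot htop

/-- Let `r` be an odd prime, `n = 2r`, `q = 2^a`, and let `V` be the fully deleted
permutation module for `Sₙ` over `𝔽_q` (so `p = 2` divides `n` and `dim V = n - 2`).
Let `g ∈ Aₙ` be a product of two disjoint `r`-cycles.  Then the characteristic
polynomial of `g` on `V` is `((X^r - 1)/(X - 1))²`, the fixed-point subspace of `g` on
`V` is zero, and `g` is not an `e`-stingray element for any `e`. -/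
theorem stmt11 (r : ℕ) (hr : r.Prime) (hrodd : Odd r)
    (n : ℕ) (hn : n = 2 * r) (a : ℕ) (ha : 0 < a) (q : ℕ) (hq : q = 2 ^ a)
    (F : Type*) [Field F] [Fintype F] (hF : Fintype.card F = q)
    (g c₁ c₂ : Equiv.Perm (Fin n)) (hgA : Equiv.Perm.sign g = 1)
    (h1 : c₁.IsCycle) (h2 : c₂.IsCycle)
    (hs1 : c₁.support.card = r) (hs2 : c₂.support.card = r)
    (hdisj : c₁.Disjoint c₂) (hg : g = c₁ * c₂) :
    Module.finrank F (DelMod F n) = n - 2 ∧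
    LinearMap.charpoly (permDel F n g) = (∑ i ∈ Finset.range r, Polynomial.X ^ i) ^ 2 ∧
    LinearMap.ker (permDel F n g - LinearMap.id) = ⊥ ∧
    ∀ e : ℕ, ¬ IsStingrayOn F (permDel F n g) e := by
  have hrpos := hr.pos
  have hr2 := hr.two_le
  have : CharP F 2 := by
    have := Fact.mk Nat.prime_two
    exact charP_of_card_eq_prime_pow (hF.trans hq)
  have hn0 : (n : F) = 0 := by simp [hn, CharTwo.two_eq_zero]
  have hdim := finrank_DelMod (F := F) (n := n) (by omega) hn0
  set P : Polynomial F := ∑ i ∈ Finset.range r, Polynomial.X ^ i with hPdef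
  have hPm : P.Monic := Polynomial.Monic.geom_sum Polynomial.monic_X (by simp) hrpos.ne'
  have hPdeg : P.natDegree = r - 1 := by
    have h := congrArg Polynomial.natDegree (geom_sum_mul (Polynomial.X : Polynomial F) r)
    rw [← hPdef, ← Polynomial.C_1, hPm.natDegree_mul (Polynomial.monic_X_sub_C 1),
      Polynomial.natDegree_X_sub_C, Polynomial.natDegree_X_pow_sub_C] at h
    omega
  have hdim' : Module.finrank F (DelMod F n) = 2 * P.natDegree := by omega
  have hgr : g ^ r = 1 := by
    have e₁ : c₁ ^ r = 1 := by rw [← hs1, ← h1.orderOf, pow_orderOf_eq_one]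
    have e₂ : c₂ ^ r = 1 := by rw [← hs2, ← h2.orderOf, pow_orderOf_eq_one]
    rw [hg, hdisj.commute.mul_pow, e₁, e₂, one_mul]
  have hcompl : c₁.supportᶜ = c₂.support := by
    symm
    apply Finset.eq_of_subset_of_card_le
    · intro i hi
      exact Finset.mem_compl.2 fun hi' =>
        Finset.disjoint_left.1 hdisj.disjoint_support hi' hi
    · rw [Finset.card_compl, Fintype.card_fin]
      omega
  obtain ⟨x, hx, -⟩ := id h1
  obtain ⟨y, hy, -⟩ := id h2
  have hgen : ∀ S : Submodule F (DelMod F n), S.map (permDel F n g) ≤ S →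
      delDiff F x (g x) ∈ S → delDiff F y (g y) ∈ S → S = ⊤ := by
    intro S hS hxS hyS
    have hpow₁ : ∀ k, (g ^ k) x = (c₁ ^ k) x := by
      intro k
      have hc : c₂ x = x := (hdisj x).resolve_left hx
      rw [hg, hdisj.commute.mul_pow, Equiv.Perm.mul_apply,
        Equiv.Perm.pow_apply_eq_self_of_apply_eq_self hc]
    have hpow₂ : ∀ k, (g ^ k) y = (c₂ ^ k) y := by
      intro k
      have hc : c₁ y = y := (hdisj y).resolve_right hy
      rw [hg, hdisj.commute.eq, hdisj.commute.symm.mul_pow, Equiv.Perm.mul_apply,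
        Equiv.Perm.pow_apply_eq_self_of_apply_eq_self hc]
    refine eq_top_of_delDiff_mem (A := c₁.support) (a := x) (b := y) (hs1 ▸ hrodd)
      (by rw [hcompl, hs2]; exact hrodd) (fun i hi => ?_) (fun i hi => ?_)
    · obtain ⟨k, rfl⟩ := h1.exists_pow_eq hx (Equiv.Perm.mem_support.1 hi)
      exact hpow₁ k ▸ delDiff_pow_mem hS hxS k
    · rw [← Finset.mem_compl, hcompl] at hi
      obtain ⟨k, rfl⟩ := h2.exists_pow_eq hy (Equiv.Perm.mem_support.1 hi)
      exact hpow₂ k ▸ delDiff_pow_mem hS hyS k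
  have hxP := aeval_permDel_delDiff (F := F) hgr x
  have hyP := aeval_permDel_delDiff (F := F) hgr y
  have hchar := charpoly_eq_sq_of_generators hPm _ hxP hyP hdim' hgen
  have hfix : LinearMap.ker (permDel F n g - LinearMap.id) = ⊥ := by
    by_contra hne
    have hev : (permDel F n g).HasEigenvalue 1 := by
      rwa [Module.End.hasEigenvalue_iff, Module.End.eigenspace_def, one_smul]
    rw [Module.End.hasEigenvalue_iff_isRoot_charpoly, hchar, Polynomial.IsRoot,
      Polynomial.eval_pow] at hev
    obtain ⟨k, rfl⟩ := hrodd
    simp [hPdef, Polynomial.eval_finsetSum, CharTwo.two_eq_zero] at hev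
  obtain ⟨S, hS, hbot, htop⟩ :=
    exists_invariant_of_generators hPm (by omega) _ hxP hyP hdim' hgen
  exact ⟨hdim, hchar, hfix, not_isStingrayOn_of_invariant hfix hS hbot htop⟩
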